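/- Let w = a₁^{k₁} a₂^{k₂} ⋯ a_σ^{k_σ} be the string of length n = k₁ + ⋯ + k_σ over a totally ordered alphabet a₁ < a₂ < … < a_σ obtained by concatenating, in increasing alphabetical order, a block of k_i copies of a_i for each i (k_i ≥ 0). Then a nonempty subsequence x of w is a Lyndon word if and only if x is not a unary string c^j of length j ≥ 2, and consequently the total number of occurrences of Lyndon subsequences in w equals (2^n − 1) − Σ_{i=1}^{σ} (2^{k_i} − 1 − k_i) = 2^n − 1 − Σ_{i=1}^{σ} 2^{k_i} + n + σ. -/

import Mathlib

/-- A nonempty string is a Lyndon word if it is lexicographically strictly smaller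
than all of its nonempty proper suffixes. -/
def IsLyndon {α : Type*} [LinearOrder α] (w : List α) : Prop :=
  w ≠ [] ∧ ∀ i, 0 < i → i < w.length → List.Lex (· < ·) w (w.drop i)

/-- The subsequence of `w` extracted at the set of positions `S` (taken in increasing order). -/
def subseqAt {α : Type*} (w : List α) (S : Finset (Fin w.length)) : List α :=
  (S.sort (· ≤ ·)).map w.get

/-- The total number of occurrences of Lyndon subsequences in `w`: the number of
(nonempty) sets of positions whose extracted word is a Lyndon word. -/
noncomputable def totalLyndonSubseq {α : Type*} [LinearOrder α] (w : List α) : ℕ :=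
  Nat.card {S : Finset (Fin w.length) // IsLyndon (subseqAt w S)}

/-- The string a₁^{k₁} a₂^{k₂} ⋯ a_σ^{k_σ} over the alphabet Fin σ. -/
def blockString (σ : ℕ) (k : Fin σ → ℕ) : List (Fin σ) :=
  (List.finRange σ).flatMap fun c => List.replicate (k c) c

theorem lex_drop_of_pairwise_le {α : Type*} [LinearOrder α] (x : List α)
    (hx : x.Pairwise (· ≤ ·)) (hu : ¬ ∃ c, ∀ b ∈ x, b = c) (i : ℕ) (hi : 0 < i)
    (hil : i < x.length) : List.Lex (· < ·) x (x.drop i) := by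
  induction x generalizing i with
  | nil => simp at hil
  | cons a l ih =>
    obtain ⟨j, rfl⟩ : ∃ j, i = j + 1 := ⟨i - 1, by omega⟩
    have hj : j < l.length := by simpa using hil
    rw [List.pairwise_cons] at hx
    rw [List.drop_succ_cons, List.drop_eq_getElem_cons hj]
    rcases (hx.1 _ (List.getElem_mem hj)).lt_or_eq with hlt | heq
    · exact List.Lex.rel hlt
    · rw [← heq]
      refine List.Lex.cons ?_
      have hnu : ¬ ∃ c, ∀ b ∈ l, b = c := by
        rintro ⟨c, hc⟩
        refine hu ⟨c, fun b hb => ?_⟩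
        rcases List.mem_cons.1 hb with rfl | hb
        · exact heq.trans (hc _ (List.getElem_mem hj))
        · exact hc b hb
      by_cases hjl : j + 1 < l.length
      · exact ih hx.2 hnu (j + 1) j.succ_pos hjl
      · refine absurd ⟨a, fun b hb => ?_⟩ hnu
        refine le_antisymm ?_ (hx.1 b hb)
        obtain ⟨m, hm, rfl⟩ := List.getElem_of_mem hb
        rw [heq]
        exact hx.2.rel_get_of_le (a := ⟨m, hm⟩) (b := ⟨j, hj⟩) (Fin.mk_le_mk.2 (by omega))

theorem isLyndon_iff_of_pairwise_le {α : Type*} [LinearOrder α] (x : List α)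
    (hx : x.Pairwise (· ≤ ·)) (hne : x ≠ []) :
    IsLyndon x ↔ ¬ (2 ≤ x.length ∧ ∃ c, ∀ b ∈ x, b = c) := by
  constructor
  · rintro ⟨-, h⟩ ⟨h2, c, hc⟩
    have hlex := h 1 one_pos (by omega)
    obtain ⟨n, rfl⟩ : ∃ n, x = List.replicate n c := ⟨_, List.eq_replicate_of_mem hc⟩
    rw [List.drop_replicate] at hlex
    have key : ∀ m n : ℕ, m ≤ n →
        ¬ List.Lex (· < ·) (List.replicate n c) (List.replicate m c) := by
      intro m
      induction m with
      | zero => exact fun n _ => List.not_lex_nil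
      | succ m ih =>
        intro n hmn h
        obtain ⟨n, rfl⟩ : ∃ p, n = p + 1 := ⟨n - 1, by omega⟩
        rw [List.replicate_succ, List.replicate_succ, List.lex_cons_iff] at h
        exact ih n (by omega) h
    exact key _ _ (Nat.sub_le _ _) hlex
  · intro h
    exact ⟨hne, fun i hi hil =>
      lex_drop_of_pairwise_le x hx (fun hu => h ⟨by omega, hu⟩) i hi hil⟩

theorem pairwise_le_blockString (σ : ℕ) (k : Fin σ → ℕ) :
    (blockString σ k).Pairwise (· ≤ ·) := by
  rw [blockString, List.pairwise_flatMap]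
  refine ⟨fun c _ => List.pairwise_replicate.2 (Or.inr le_rfl), ?_⟩
  refine (List.pairwise_lt_finRange σ).imp fun {a b} hab x hx y hy => ?_
  rw [List.eq_of_mem_replicate hx, List.eq_of_mem_replicate hy]
  exact hab.le

theorem count_blockString (σ : ℕ) (k : Fin σ → ℕ) (c : Fin σ) :
    (blockString σ k).count c = k c := by
  rw [blockString, List.count_flatMap]
  simp [Function.comp_def, List.count_replicate, ← List.ofFn_eq_map, List.sum_ofFn]

theorem length_blockString (σ : ℕ) (k : Fin σ → ℕ) :
    (blockString σ k).length = ∑ i, k i := by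
  simp [blockString, List.length_flatMap, ← List.ofFn_eq_map, List.sum_ofFn]

theorem length_subseqAt {α : Type*} (w : List α) (S : Finset (Fin w.length)) :
    (subseqAt w S).length = S.card := by
  simp [subseqAt]

theorem mem_subseqAt {α : Type*} (w : List α) (S : Finset (Fin w.length)) (b : α) :
    b ∈ subseqAt w S ↔ ∃ i ∈ S, w.get i = b := by
  simp [subseqAt]

theorem pairwise_le_subseqAt {α : Type*} [LinearOrder α] (w : List α)
    (hw : w.Pairwise (· ≤ ·)) (S : Finset (Fin w.length)) :
    (subseqAt w S).Pairwise (· ≤ ·) := by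
  rw [subseqAt, List.pairwise_map]
  exact (Finset.pairwise_sort S (· ≤ ·)).imp fun hab => hw.rel_get_of_le hab

theorem card_filter_get_eq {α : Type*} [DecidableEq α] (w : List α) (c : α) :
    (Finset.univ.filter fun i : Fin w.length => w.get i = c).card = w.count c := by
  have h := (List.nodup_finRange w.length).card_eq_countP (P := fun i => w.get i = c)
  rw [List.toFinset_finRange] at h
  rw [h]
  conv_rhs => rw [← List.map_get_finRange w, List.count, List.countP_map]
  exact List.countP_congr fun i _ => by simp

theorem card_powerset_filter_two_le_card {ι : Type*} [DecidableEq ι] (P : Finset ι) :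
    (P.powerset.filter fun S => 2 ≤ S.card).card + 1 + P.card = 2 ^ P.card := by
  have h := Finset.card_filter_add_card_filter_not (s := P.powerset) (fun S => 2 ≤ S.card)
  have hsmall : P.powerset.filter (fun S => ¬ 2 ≤ S.card)
      = P.powersetCard 0 ∪ P.powersetCard 1 := by
    ext S
    simp only [Finset.mem_filter, Finset.mem_powerset, Finset.mem_union, Finset.mem_powersetCard]
    constructor
    · rintro ⟨h1, h2⟩
      have : S.card = 0 ∨ S.card = 1 := by omega
      tauto
    · rintro (⟨h1, h2⟩ | ⟨h1, h2⟩) <;> exact ⟨h1, by omega⟩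
  rw [hsmall, Finset.card_union_of_disjoint
    (Finset.pairwise_disjoint_powersetCard P zero_ne_one), Finset.card_powersetCard,
    Finset.card_powersetCard, Finset.card_powerset, Nat.choose_zero_right,
    Nat.choose_one_right] at h
  omega

theorem totalLyndonSubseq_add_of_pairwise_le {α : Type*} [LinearOrder α] [Fintype α]
    (w : List α) (hw : w.Pairwise (· ≤ ·)) :
    (totalLyndonSubseq w : ℤ) + 1 + ∑ c, ((2 : ℤ) ^ w.count c - 1 - w.count c)
      = 2 ^ w.length := by
  classical
  let P : α → Finset (Fin w.length) := fun c => Finset.univ.filter fun i => w.get i = c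
  let U : α → Finset (Finset (Fin w.length)) := fun c =>
    (P c).powerset.filter fun S => 2 ≤ S.card
  have hU : ∀ c, ((U c).card : ℤ) = 2 ^ w.count c - 1 - w.count c := by
    intro c
    have h := card_powerset_filter_two_le_card (P c)
    rw [card_filter_get_eq w c] at h
    have hsum : ((U c).card : ℤ) + 1 + w.count c = 2 ^ w.count c := by exact_mod_cast h
    linarith
  have hdisj : Set.PairwiseDisjoint (Finset.univ : Finset α) U := by
    intro c _ d _ hcd
    refine Finset.disjoint_left.2 fun S hc hd => hcd ?_
    simp only [U, P, Finset.mem_filter, Finset.mem_powerset] at hc hd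
    obtain ⟨i, hi⟩ := Finset.card_pos.1 (show 0 < S.card by omega)
    exact (Finset.mem_filter.1 (hc.1 hi)).2.symm.trans (Finset.mem_filter.1 (hd.1 hi)).2
  have hempty : (∅ : Finset (Fin w.length)) ∉ Finset.univ.biUnion U := by
    simp [U]
  have hnot : (Finset.univ.filter fun S : Finset (Fin w.length) => ¬ IsLyndon (subseqAt w S))
      = insert ∅ (Finset.univ.biUnion U) := by
    ext S
    simp only [Finset.mem_filter, Finset.mem_univ, true_and, Finset.mem_insert,
      Finset.mem_biUnion]
    rcases S.eq_empty_or_nonempty with rfl | hS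
    · simp [IsLyndon, subseqAt]
    · have hne : subseqAt w S ≠ [] := by
        rw [← List.length_pos_iff, length_subseqAt]
        exact hS.card_pos
      rw [isLyndon_iff_of_pairwise_le _ (pairwise_le_subseqAt w hw S) hne, not_not,
        length_subseqAt]
      simp only [hS.ne_empty, false_or, U, P, Finset.mem_filter, Finset.mem_powerset,
        Finset.subset_iff, Finset.mem_univ, true_and, mem_subseqAt, forall_exists_index, and_imp,
        forall_apply_eq_imp_iff₂]
      tauto
  have hcard := Finset.card_filter_add_card_filter_not
    (s := (Finset.univ : Finset (Finset (Fin w.length)))) (fun S => IsLyndon (subseqAt w S))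
  rw [hnot, Finset.card_insert_of_notMem hempty, Finset.card_biUnion hdisj, Finset.card_univ,
    Fintype.card_finset, Fintype.card_fin] at hcard
  have htot : totalLyndonSubseq w
      = (Finset.univ.filter fun S : Finset (Fin w.length) => IsLyndon (subseqAt w S)).card := by
    rw [totalLyndonSubseq, Nat.card_eq_fintype_card, Fintype.card_subtype]
  rw [← htot] at hcard
  have hcast := congrArg (Nat.cast : ℕ → ℤ) hcard
  push_cast at hcast
  rw [← hcast, Finset.sum_congr rfl fun c _ => hU c]
  ring

theorem lyndon_subsequences_of_block_string (σ : ℕ) (k : Fin σ → ℕ) :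
    (∀ x : List (Fin σ), x.Sublist (blockString σ k) → x ≠ [] →
        (IsLyndon x ↔ ¬ (2 ≤ x.length ∧ ∃ c : Fin σ, x = List.replicate x.length c))) ∧
    (totalLyndonSubseq (blockString σ k) : ℤ)
      = (2 ^ (∑ i, k i) - 1) - ∑ i, ((2 : ℤ) ^ (k i) - 1 - (k i : ℤ)) ∧
    (totalLyndonSubseq (blockString σ k) : ℤ)
      = 2 ^ (∑ i, k i) - 1 - (∑ i, (2 : ℤ) ^ (k i)) + (∑ i, (k i : ℤ)) + σ := by
  have htotal := totalLyndonSubseq_add_of_pairwise_le _ (pairwise_le_blockString σ k)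
  simp only [count_blockString, length_blockString] at htotal
  refine ⟨fun x hx hne => ?_, by linarith, ?_⟩
  · rw [isLyndon_iff_of_pairwise_le x ((pairwise_le_blockString σ k).sublist hx) hne]
    simp [List.eq_replicate_iff]
  · simp only [Finset.sum_sub_distrib, Finset.sum_const, Finset.card_univ, Fintype.card_fin,
      nsmul_eq_mul, mul_one] at htotal
    linarith
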